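/- If 1 ≤ a ≤ a* (where a* = 4π e^{-γ}), then every zero of φ₀(a,·) lies on the critical line: if s ∈ ℂ, s ∉ {0, 1/2, 1}, and φ₀(a,s) = 0, then Re(s) = 1/2. -/

import Mathlib

open Complex

/-- The constant term `φ₀(a,s) = Λ(2s) a^s + Λ(2s-1) a^{1-s}` of the completed
nonholomorphic Eisenstein series for the modular group, where `Λ` is the completed
Riemann zeta function. -/
noncomputable def phi0 (a : ℝ) (s : ℂ) : ℂ :=
  completedRiemannZeta (2 * s) * (a : ℂ) ^ s +
    completedRiemannZeta (2 * s - 1) * (a : ℂ) ^ (1 - s)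

/-- The critical value `a* = 4 π e^{-γ}`, where `γ` is the Euler–Mascheroni constant. -/
noncomputable def aStar : ℝ := 4 * Real.pi * Real.exp (-Real.eulerMascheroniConstant)

section

open Set Filter Topology MeasureTheory Asymptotics Bornology ComplexConjugate

/-- The negated fractional part on `(1, ∞)`, extended by zero. -/
noncomputable def floorSub (t : ℝ) : ℂ := (Ioi (1 : ℝ)).indicator (fun x ↦ ((⌊x⌋₊ : ℂ) - x)) t

lemma measurable_floorSub : Measurable floorSub := by
  unfold floorSub
  refine Measurable.indicator ?_ measurableSet_Ioi
  exact (measurable_from_nat.comp Nat.measurable_floor).sub (by fun_prop)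

lemma norm_floorSub_le (t : ℝ) : ‖floorSub t‖ ≤ (Ioi (1 : ℝ)).indicator (fun _ ↦ (1 : ℝ)) t := by
  unfold floorSub
  rw [norm_indicator_eq_indicator_norm]
  refine indicator_le_indicator' fun ht ↦ ?_
  have ht : (1 : ℝ) < t := ht
  have h1 := Nat.floor_le (zero_le_one.trans ht.le)
  have h2 := Nat.lt_floor_add_one t
  have : ((⌊t⌋₊ : ℂ) - t) = ((⌊t⌋₊ - t : ℝ) : ℂ) := by push_cast; rfl
  rw [this, norm_real, Real.norm_eq_abs, abs_le]
  constructor <;> linarith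

lemma norm_floorSub_le_one (t : ℝ) : ‖floorSub t‖ ≤ 1 :=
  (norm_floorSub_le t).trans (indicator_le_self' (by simp) t)

lemma differentiableAt_mellin_floorSub {s : ℂ} (hs : s.re < 0) :
    DifferentiableAt ℂ (mellin floorSub) s := by
  refine mellin_differentiableAt_of_isBigO_rpow (a := 0) (b := s.re - 1) ?_ ?_ hs ?_ (by linarith)
  · refine LocallyIntegrable.locallyIntegrableOn ?_ _
    exact (locallyIntegrable_const (1 : ℝ)).mono measurable_floorSub.aestronglyMeasurable
      (ae_of_all _ fun t ↦ by simpa using norm_floorSub_le_one t)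
  · refine isBigO_of_le _ fun t ↦ ?_
    simpa using norm_floorSub_le_one t
  · refine (isBigO_zero _ _).congr' ?_ EventuallyEq.rfl
    filter_upwards [Ioo_mem_nhdsGT (zero_lt_one' ℝ)] with t ht
    simp [floorSub, ht.2.le]

lemma mellin_floorSub_neg (s : ℂ) :
    mellin floorSub (-s) = ∫ t in Ioi (1 : ℝ), (t : ℂ) ^ (-s - 1) * ((⌊t⌋₊ : ℂ) - t) := by
  have : ∀ t : ℝ, (t : ℂ) ^ (-s - 1) • floorSub t =
      (Ioi (1 : ℝ)).indicator (fun t : ℝ ↦ (t : ℂ) ^ (-s - 1) * ((⌊t⌋₊ : ℂ) - t)) t := by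
    intro t
    by_cases ht : t ∈ Ioi (1 : ℝ) <;> simp [floorSub, ht]
  simp_rw [mellin, this]
  rw [setIntegral_indicator measurableSet_Ioi]
  congr 2
  rw [inter_eq_right]
  exact Ioi_subset_Ioi zero_le_one

lemma norm_mellin_floorSub_neg_le {s : ℂ} (hs : 0 < s.re) :
    ‖mellin floorSub (-s)‖ ≤ 1 / s.re := by
  rw [mellin_floorSub_neg]
  have hint : IntegrableOn (fun t : ℝ ↦ t ^ (-s.re - 1)) (Ioi 1) :=
    integrableOn_Ioi_rpow_of_lt (by linarith) one_pos
  refine (norm_integral_le_of_norm_le hint ?_).trans_eq ?_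
  · refine (ae_restrict_iff' measurableSet_Ioi).2 (ae_of_all _ fun t ht ↦ ?_)
    have h0 : (0 : ℝ) < t := zero_lt_one.trans ht
    have := norm_floorSub_le_one t
    rw [floorSub, indicator_of_mem ht] at this
    rw [norm_mul, norm_cpow_eq_rpow_re_of_pos h0]
    simpa using mul_le_of_le_one_right (Real.rpow_nonneg h0.le _) this
  · rw [integral_Ioi_rpow_of_lt (by linarith) one_pos]
    simp

lemma riemannZeta₁_eq_of_one_lt_re {s : ℂ} (hs : 1 < s.re) :
    riemannZeta₁ s = s + s * (s - 1) * mellin floorSub (-s) := by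
  have hs1 : s ≠ 1 := by rintro rfl; simp at hs
  have hs1' : s - 1 ≠ 0 := sub_ne_zero.2 hs1
  have hz : riemannZeta s = s * ∫ t in Ioi (1 : ℝ), (⌊t⌋₊ : ℂ) * (t : ℂ) ^ (-(s + 1)) := by
    rw [← LSeries_one_eq_riemannZeta hs, LSeries_eq_mul_integral 1 zero_le_one hs]
    · simp
    · exact LSeriesSummable_one_iff.2 hs
    · refine isBigO_of_le _ fun n ↦ ?_
      simp
  have hint1 : IntegrableOn (fun t : ℝ ↦ (t : ℂ) ^ (-s)) (Ioi 1) :=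
    integrableOn_Ioi_cpow_of_lt (by simpa using hs) one_pos
  have hint2 : IntegrableOn (fun t : ℝ ↦ (t : ℂ) ^ (-s - 1) * ((⌊t⌋₊ : ℂ) - t)) (Ioi 1) := by
    refine Integrable.mono' (g := fun t : ℝ ↦ t ^ (-s.re - 1))
      (integrableOn_Ioi_rpow_of_lt (by linarith) one_pos) ?_ ?_
    · refine AEStronglyMeasurable.mul ?_ ?_
      · exact (integrableOn_Ioi_cpow_of_lt (a := -s - 1) (by simp; linarith) one_pos).1
      · exact ((measurable_from_nat.comp Nat.measurable_floor).sub
          (by fun_prop)).aestronglyMeasurable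
    · refine (ae_restrict_iff' measurableSet_Ioi).2 (ae_of_all _ fun t ht ↦ ?_)
      have h0 : (0 : ℝ) < t := zero_lt_one.trans ht
      have := norm_floorSub_le_one t
      rw [floorSub, indicator_of_mem ht] at this
      rw [norm_mul, norm_cpow_eq_rpow_re_of_pos h0]
      simpa using mul_le_of_le_one_right (Real.rpow_nonneg h0.le _) this
  have hsum : ∫ t in Ioi (1 : ℝ), (⌊t⌋₊ : ℂ) * (t : ℂ) ^ (-(s + 1)) =
      1 / (s - 1) + mellin floorSub (-s) := by
    have h1 : ∫ t in Ioi (1 : ℝ), (t : ℂ) ^ (-s) = 1 / (s - 1) := by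
      rw [integral_Ioi_cpow_of_lt (by simpa using hs) one_pos]
      have : -s + 1 ≠ 0 := by contrapose! hs1'; linear_combination -hs1'
      simp only [ofReal_one, one_cpow]
      rw [div_eq_div_iff this hs1']
      ring
    rw [mellin_floorSub_neg, ← h1, ← integral_add hint1 hint2]
    refine setIntegral_congr_fun measurableSet_Ioi fun t ht ↦ ?_
    have h0 : (t : ℂ) ≠ 0 := by exact_mod_cast (zero_lt_one.trans ht).ne'
    have h2 : (t : ℂ) ^ (-s) = t ^ (-s - 1) * t := by
      rw [cpow_sub _ _ h0, cpow_one, div_mul_cancel₀ _ h0]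
    simp only [h2, neg_add']
    ring
  have h2 := riemannZeta_eq_inv_sub_mul hs1
  rw [eq_inv_mul_iff_mul_eq₀ hs1'] at h2
  rw [← h2, hz, hsum]
  field_simp

lemma riemannZeta₁_eq {s : ℂ} (hs : 0 < s.re) :
    riemannZeta₁ s = s + s * (s - 1) * mellin floorSub (-s) := by
  have hopen : IsOpen {z : ℂ | 0 < z.re} := isOpen_lt continuous_const continuous_re
  have h1 : AnalyticOnNhd ℂ riemannZeta₁ {z : ℂ | 0 < z.re} :=
    differentiable_riemannZeta₁.differentiableOn.analyticOnNhd hopen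
  have h2 : AnalyticOnNhd ℂ (fun s ↦ s + s * (s - 1) * mellin floorSub (-s))
      {z : ℂ | 0 < z.re} := by
    refine DifferentiableOn.analyticOnNhd (fun z hz ↦ ?_) hopen
    have hz : 0 < z.re := hz
    have : DifferentiableAt ℂ (fun s ↦ mellin floorSub (-s)) z :=
      (differentiableAt_mellin_floorSub (s := -z) (by simpa using hz)).comp z
        differentiableAt_id.neg
    exact DifferentiableAt.differentiableWithinAt (by fun_prop)
  refine h1.eqOn_of_preconnected_of_eventuallyEq h2 (convex_halfSpace_re_gt 0).isPreconnected
    (z₀ := 2) (by simp) ?_ hs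
  filter_upwards [(isOpen_lt continuous_const continuous_re).mem_nhds
    (show (1 : ℝ) < (2 : ℂ).re by simp)] with z hz
  exact riemannZeta₁_eq_of_one_lt_re hz

lemma norm_riemannZeta₁_le {s : ℂ} (hs : 0 < s.re) :
    ‖riemannZeta₁ s‖ ≤ ‖s‖ * (1 + ‖s - 1‖ / s.re) := by
  rw [riemannZeta₁_eq hs]
  refine (norm_add_le _ _).trans ?_
  rw [norm_mul, norm_mul]
  have := mul_le_mul_of_nonneg_left (norm_mellin_floorSub_neg_le hs)
    (by positivity : 0 ≤ ‖s‖ * ‖s - 1‖)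
  refine (add_le_add_right this _).trans_eq ?_
  ring

lemma norm_riemannZeta_inv_le {s : ℂ} (hs : 0 < s.re) :
    ‖(riemannZeta (1 + s))⁻¹‖ ≤ 2 + 1 / s.re := by
  have h1 : 1 < (1 + s).re := by simpa using hs
  have hinv : (riemannZeta (1 + s))⁻¹ = LSeries (fun n ↦ (ArithmeticFunction.moebius n : ℂ)) (1 + s) := by
    have := ArithmeticFunction.LSeries_zeta_mul_Lseries_moebius h1
    rw [ArithmeticFunction.LSeries_zeta_eq_riemannZeta h1] at this
    exact inv_eq_of_mul_eq_one_right this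
  have hx : 1 < ((1 + s.re : ℝ) : ℂ).re := by simpa using hs
  have hsum := LSeriesSummable_one_iff.2 hx
  have hterm (n : ℕ) : ‖LSeries.term (fun n ↦ (ArithmeticFunction.moebius n : ℂ)) (1 + s) n‖ ≤
      ‖LSeries.term 1 ((1 + s.re : ℝ) : ℂ) n‖ := by
    rw [LSeries.norm_term_eq, LSeries.norm_term_eq]
    split_ifs with h
    · rfl
    · simp only [Pi.one_apply, norm_one, add_re, one_re, ofReal_re]
      gcongr
      have := ArithmeticFunction.abs_moebius_le_one (n := n)
      rw [norm_intCast]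
      exact_mod_cast this
  have hz : ∑' n, ‖LSeries.term 1 ((1 + s.re : ℝ) : ℂ) n‖ = ‖riemannZeta ((1 + s.re : ℝ) : ℂ)‖ := by
    have hterm' (n : ℕ) : LSeries.term 1 ((1 + s.re : ℝ) : ℂ) n =
        ((‖LSeries.term 1 ((1 + s.re : ℝ) : ℂ) n‖ : ℝ) : ℂ) := by
      rw [LSeries.norm_term_eq, LSeries.term_def]
      split_ifs with h
      · simp
      · rw [ofReal_div, ofReal_cpow (by positivity)]
        simp
    rw [← LSeries_one_eq_riemannZeta hx, LSeries, tsum_congr hterm', ← ofReal_tsum, norm_real,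
      Real.norm_of_nonneg (tsum_nonneg fun _ ↦ norm_nonneg _)]
  rw [hinv]
  calc _ ≤ ∑' n, ‖LSeries.term 1 ((1 + s.re : ℝ) : ℂ) n‖ :=
        tsum_of_norm_bounded hsum.norm.hasSum hterm
    _ = ‖riemannZeta ((1 + s.re : ℝ) : ℂ)‖ := hz
    _ ≤ 2 + 1 / s.re := by
      have hne : ((1 + s.re : ℝ) : ℂ) ≠ 1 := by exact_mod_cast (by linarith : 1 + s.re ≠ 1)
      rw [riemannZeta_eq_inv_sub_mul hne, norm_mul, norm_inv]
      have h := norm_riemannZeta₁_le (s := ((1 + s.re : ℝ) : ℂ)) (by simp; linarith)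
      have e1 : ((1 + s.re : ℝ) : ℂ) - 1 = (s.re : ℂ) := by push_cast; ring
      rw [e1] at h ⊢
      rw [norm_real, norm_real, Real.norm_of_nonneg (by linarith), Real.norm_of_nonneg hs.le,
        ofReal_re] at h
      rw [norm_real, Real.norm_of_nonneg hs.le, inv_mul_le_iff₀ hs]
      refine h.trans_eq ?_
      field_simp
      ring

/-- The entire function `s ↦ s (s - 1) Λ(s)`, normalised so that its value at `0` and `1` is `1`. -/
noncomputable def entireXi (s : ℂ) : ℂ := 1 + s * (s - 1) * completedRiemannZeta₀ s

lemma differentiable_entireXi : Differentiable ℂ entireXi := by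
  have := differentiable_completedZeta₀
  unfold entireXi
  fun_prop

lemma entireXi_one_sub (s : ℂ) : entireXi (1 - s) = entireXi s := by
  rw [entireXi, completedRiemannZeta₀_one_sub, entireXi]
  ring

lemma entireXi_zero : entireXi 0 = 1 := by simp [entireXi]

lemma entireXi_one : entireXi 1 = 1 := by simp [entireXi]

lemma entireXi_eq {s : ℂ} (h0 : s ≠ 0) (h1 : s ≠ 1) :
    entireXi s = s * (s - 1) * completedRiemannZeta s := by
  have h1' : 1 - s ≠ 0 := sub_ne_zero.2 h1.symm
  rw [entireXi, completedRiemannZeta_eq]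
  field_simp
  ring

lemma completedRiemannZeta_eq_Gammaℝ_mul {s : ℂ} (hs : 0 < s.re) :
    completedRiemannZeta s = Gammaℝ s * riemannZeta s := by
  rw [riemannZeta_def_of_ne_zero (by rintro rfl; simp at hs),
    mul_div_cancel₀ _ (Gammaℝ_ne_zero_of_re_pos hs)]

lemma entireXi_eq_Gammaℝ_mul {s : ℂ} (hs : 0 < s.re) :
    entireXi s = s * Gammaℝ s * riemannZeta₁ s := by
  rcases eq_or_ne s 1 with rfl | h1
  · simp [entireXi_one]
  · have h1' : s - 1 ≠ 0 := sub_ne_zero.2 h1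
    rw [entireXi_eq (by rintro rfl; simp at hs) h1, completedRiemannZeta_eq_Gammaℝ_mul hs,
      riemannZeta_eq_inv_sub_mul h1]
    field_simp

lemma entireXi_ne_zero {s : ℂ} (hs : 1 ≤ s.re) : entireXi s ≠ 0 := by
  rcases eq_or_ne s 1 with rfl | h1
  · simp [entireXi_one]
  · have h0 : s ≠ 0 := by rintro rfl; norm_num at hs
    rw [entireXi_eq h0 h1, completedRiemannZeta_eq_Gammaℝ_mul (by linarith)]
    exact mul_ne_zero (mul_ne_zero h0 (sub_ne_zero.2 h1))
      (mul_ne_zero (Gammaℝ_ne_zero_of_re_pos (by linarith))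
        (riemannZeta_ne_zero_of_one_le_re hs))

lemma Gammaℝ_conj (s : ℂ) : Gammaℝ (conj s) = conj (Gammaℝ s) := by
  have h : ((Real.pi : ℂ)).arg ≠ Real.pi := by
    rw [arg_ofReal_of_nonneg Real.pi_pos.le]; exact Real.pi_pos.ne
  rw [Gammaℝ_def, Gammaℝ_def, map_mul, ← Gamma_conj]
  congr 1
  · have := cpow_conj (Real.pi : ℂ) (-s / 2) h
    simp only [conj_ofReal] at this
    rw [← this]; simp [map_ofNat]
  · simp [map_ofNat]

lemma entireXi_conj_of_re_pos {s : ℂ} (hs : 0 < s.re) :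
    entireXi (conj s) = conj (entireXi s) := by
  rcases eq_or_ne s 1 with rfl | h1
  · simp [entireXi_one]
  have h1' : conj s ≠ 1 := by
    intro h; apply h1; rw [← conj_conj s, h, map_one]
  have h0 : s ≠ 0 := by rintro rfl; simp at hs
  rw [entireXi_eq (by simpa using h0) h1', entireXi_eq h0 h1,
    completedRiemannZeta_eq_Gammaℝ_mul hs, completedRiemannZeta_eq_Gammaℝ_mul (by simpa using hs),
    riemannZeta_conj, Gammaℝ_conj]
  simp

/-- The quotient `ξ(u) / ξ(1 + u)`. -/
noncomputable def xiRatio (u : ℂ) : ℂ := entireXi u / entireXi (1 + u)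

lemma entireXi_one_add_ne_zero {u : ℂ} (hu : 0 ≤ u.re) : entireXi (1 + u) ≠ 0 :=
  entireXi_ne_zero (by simpa using hu)

lemma differentiableAt_xiRatio {u : ℂ} (hu : 0 ≤ u.re) : DifferentiableAt ℂ xiRatio u := by
  have := differentiable_entireXi
  exact (this u).div ((this (1 + u)).comp u (by fun_prop)) (entireXi_one_add_ne_zero hu)

lemma norm_xiRatio_mul_I (x : ℝ) : ‖xiRatio (x * I)‖ = 1 := by
  have h : entireXi (x * I) = conj (entireXi (1 + x * I)) := by
    rw [← entireXi_conj_of_re_pos (by simp), ← entireXi_one_sub]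
    congr 1
    simp [sub_eq_add_neg]
  rw [xiRatio, norm_div, h, norm_conj, div_self]
  simpa using entireXi_one_add_ne_zero (u := x * I) (by simp)

lemma norm_betaIntegral_add_one_half_le {s : ℂ} (hs : 0 < s.re) :
    ‖betaIntegral (s + 1) (1 / 2)‖ ≤ 2 := by
  have hnorm : ∀ x ∈ Ioc (0 : ℝ) 1,
      ‖(x : ℂ) ^ (s + 1 - 1) * (1 - (x : ℂ)) ^ ((1 / 2 : ℂ) - 1)‖ ≤ (1 - x) ^ (-(1 / 2) : ℝ) := by
    intro x hx
    rcases hx.2.eq_or_lt with rfl | h1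
    · have h2 : (1 / 2 : ℂ) - 1 ≠ 0 := by norm_num
      rw [ofReal_one, sub_self, zero_cpow h2, mul_zero, norm_zero]
      exact Real.rpow_nonneg (by norm_num) _
    have : (1 - (x : ℂ)) = ((1 - x : ℝ) : ℂ) := by push_cast; rfl
    rw [norm_mul, this, norm_cpow_eq_rpow_re_of_pos hx.1,
      norm_cpow_eq_rpow_re_of_pos (by linarith)]
    have h2 : ((1 / 2 : ℂ) - 1).re = -(1 / 2) := by norm_num
    rw [h2]
    refine mul_le_of_le_one_left (Real.rpow_nonneg (by linarith) _) ?_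
    exact Real.rpow_le_one hx.1.le hx.2 (by simpa using hs.le)
  have hbase : IntervalIntegrable (fun x : ℝ ↦ x ^ (-(1 / 2) : ℝ)) volume 0 1 :=
    intervalIntegral.intervalIntegrable_rpow' (by norm_num)
  have hint : IntervalIntegrable (fun x : ℝ ↦ (1 - x) ^ (-(1 / 2) : ℝ)) volume 0 1 := by
    simpa using (hbase.comp_sub_left 1).symm
  refine (intervalIntegral.norm_integral_le_of_norm_le zero_le_one
    (ae_of_all _ hnorm) hint).trans_eq ?_
  rw [intervalIntegral.integral_comp_sub_left (fun x : ℝ ↦ x ^ (-(1 / 2) : ℝ)) 1,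
    integral_rpow (Or.inl (by norm_num))]
  norm_num

lemma norm_Gammaℝ_ratio_le {u : ℂ} (hu : 0 < u.re) :
    ‖u * Gammaℝ u / ((1 + u) * Gammaℝ (1 + u))‖ ≤ 2 := by
  have hu0 : u ≠ 0 := by rintro rfl; simp at hu
  have hu1 : 1 + u ≠ 0 := by
    intro h; have := congrArg re h; simp at this; linarith
  have hre : 0 < (u / 2).re := by simpa using hu
  have hbeta := Gamma_mul_Gamma_eq_betaIntegral (s := u / 2 + 1) (t := 1 / 2)
    (by rw [add_re, one_re]; linarith) (by norm_num)
  have e1 : u / 2 + 1 + 1 / 2 = (1 + u) / 2 + 1 := by ring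
  have h2 : (1 + u) / 2 ≠ 0 := div_ne_zero hu1 two_ne_zero
  have h3 : u / 2 ≠ 0 := div_ne_zero hu0 two_ne_zero
  have hG : Gamma ((1 + u) / 2) ≠ 0 := by
    refine Gamma_ne_zero_of_re_pos ?_
    have : ((1 + u) / 2).re = (1 + u.re) / 2 := by simp
    rw [this]; linarith
  rw [e1, Gamma_add_one _ h2, Gamma_add_one _ h3, Gamma_one_half_eq] at hbeta
  have hpi : (Real.pi : ℂ) ≠ 0 := by exact_mod_cast Real.pi_ne_zero
  have hpi2 : (Real.pi : ℂ) ^ (1 / 2 : ℂ) ≠ 0 := by simp [cpow_eq_zero_iff, hpi]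
  have key : u * Gammaℝ u / ((1 + u) * Gammaℝ (1 + u)) = betaIntegral (u / 2 + 1) (1 / 2) := by
    have e2 : (-u / 2 : ℂ) = -(1 + u) / 2 + 1 / 2 := by ring
    rw [Gammaℝ_def, Gammaℝ_def, e2, cpow_add _ _ hpi]
    have h4 : (Real.pi : ℂ) ^ (-(1 + u) / 2) ≠ 0 := by simp [cpow_eq_zero_iff, hpi]
    rw [div_eq_iff (mul_ne_zero hu1 (mul_ne_zero h4 hG))]
    linear_combination (2 * (Real.pi : ℂ) ^ (-(1 + u) / 2)) * hbeta
  rw [key]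
  exact norm_betaIntegral_add_one_half_le hre

lemma norm_xiRatio_le {u : ℂ} (hu : 0 < u.re) :
    ‖xiRatio u‖ ≤ 2 * (1 + ‖u - 1‖ / u.re) * (2 + 1 / u.re) := by
  have hu0 : u ≠ 0 := by rintro rfl; simp at hu
  have h1u : 0 < (1 + u).re := by simp; linarith
  have hne : (1 + u) ≠ 1 := by simpa using hu0
  have hz : riemannZeta₁ (1 + u) = u * riemannZeta (1 + u) := by
    rw [riemannZeta_eq_inv_sub_mul hne]
    simp [hu0]
  have key : xiRatio u = u * Gammaℝ u / ((1 + u) * Gammaℝ (1 + u)) * (riemannZeta₁ u / u) *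
      (riemannZeta (1 + u))⁻¹ := by
    rw [xiRatio, entireXi_eq_Gammaℝ_mul hu, entireXi_eq_Gammaℝ_mul h1u, hz]
    simp only [div_eq_mul_inv, mul_inv]
    ring
  rw [key, norm_mul, norm_mul]
  gcongr
  · exact norm_Gammaℝ_ratio_le hu
  · rw [norm_div, div_le_iff₀' (norm_pos_iff.2 hu0)]
    exact norm_riemannZeta₁_le hu
  · exact norm_riemannZeta_inv_le hu

lemma norm_xiRatio_le_of_re_le_one {u : ℂ} (hu : 0 < u.re) (hu1 : u.re ≤ 1) :
    u.re ^ 2 * ‖xiRatio u‖ ≤ 6 * (2 + ‖u‖) := by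
  have h1 : ‖u - 1‖ ≤ ‖u‖ + 1 := by simpa using norm_sub_le u 1
  have h2 : u.re + ‖u - 1‖ ≤ 2 + ‖u‖ := by linarith
  calc u.re ^ 2 * ‖xiRatio u‖
      ≤ u.re ^ 2 * (2 * (1 + ‖u - 1‖ / u.re) * (2 + 1 / u.re)) := by
        gcongr; exact norm_xiRatio_le hu
    _ = 2 * (u.re + ‖u - 1‖) * (2 * u.re + 1) := by field_simp
    _ ≤ 2 * (2 + ‖u‖) * (2 * 1 + 1) := by gcongr
    _ = 6 * (2 + ‖u‖) := by ring

lemma norm_xiRatio_le_of_one_le_re {u : ℂ} (hu : 1 ≤ u.re) :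
    ‖xiRatio u‖ ≤ 6 * (2 + ‖u‖) := by
  have h1 : ‖u - 1‖ ≤ ‖u‖ + 1 := by simpa using norm_sub_le u 1
  refine (norm_xiRatio_le (by linarith)).trans ?_
  have h2 : ‖u - 1‖ / u.re ≤ ‖u‖ + 1 := (div_le_self (norm_nonneg _) hu).trans h1
  have h3 : 1 / u.re ≤ 1 := (div_le_one (by linarith)).2 hu
  calc _ ≤ 2 * (1 + (‖u‖ + 1)) * (2 + 1) := by gcongr
    _ = _ := by ring

lemma norm_xiRatio_le_linear {u : ℂ} (hu : 0 < u.re) : ‖xiRatio u‖ ≤ 54 * (5 + ‖u‖) := by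
  have hun := norm_nonneg u
  rcases le_or_gt 1 u.re with h1 | h1
  · have := norm_xiRatio_le_of_one_le_re h1
    linarith
  -- The squared factor vanishes at the two left corners of the rectangle, to second order.
  set P : ℂ → ℂ := fun w ↦ ((w - u.im * I) ^ 2 + 1) ^ 2 with hP
  set U : Set ℂ := Ioo (0 : ℝ) 1 ×ℂ Ioo (u.im - 1) (u.im + 1) with hU
  have him : u.im - 1 < u.im + 1 := by linarith
  have hcl : closure U = Icc (0 : ℝ) 1 ×ℂ Icc (u.im - 1) (u.im + 1) := by
    rw [hU, closure_reProdIm, closure_Ioo zero_ne_one, closure_Ioo him.ne]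
  have hbdd : IsBounded U :=
    (Metric.isBounded_Ioo _ _).reProdIm (Metric.isBounded_Ioo _ _)
  have hd : DiffContOnCl ℂ (fun w ↦ P w * xiRatio w) U := by
    refine DifferentiableOn.diffContOnCl fun w hw ↦ ?_
    rw [hcl, mem_reProdIm] at hw
    have := differentiableAt_xiRatio hw.1.1
    exact DifferentiableAt.differentiableWithinAt (by fun_prop)
  have hbound : ∀ w ∈ frontier U, ‖P w * xiRatio w‖ ≤ 54 * (5 + ‖u‖) := by
    intro w hw
    have hwcl : w ∈ closure U := frontier_subset_closure hw
    rw [hcl, mem_reProdIm] at hwcl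
    obtain ⟨⟨hx0, hx1⟩, hy0, hy1⟩ := hwcl
    set x := w.re
    set y := w.im - u.im with hy
    have hwu : w - u.im * I = x + y * I := by
      apply Complex.ext <;> simp [x, y]
    have hPn : ‖P w‖ = (x ^ 2 - y ^ 2 + 1) ^ 2 + (2 * x * y) ^ 2 := by
      rw [hP]
      simp only [hwu, norm_pow, ← normSq_eq_norm_sq, normSq_apply]
      simp [pow_two]
      ring
    have hyb : y ^ 2 ≤ 1 := by
      rw [sq_le_one_iff_abs_le_one, abs_le]; constructor <;> linarith
    have hx2 : x ^ 2 ≤ 1 := by nlinarith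
    have hy2 := sq_nonneg y
    have hxx := sq_nonneg x
    rcases hx0.eq_or_lt with hx | hx
    · have hw0 : w = (w.im : ℝ) * I := by
        have hre : w.re = 0 := hx.symm
        apply Complex.ext <;> simp [hre]
      have : ‖xiRatio w‖ = 1 := by rw [hw0]; exact norm_xiRatio_mul_I _
      rw [norm_mul, this, hPn, ← hx]
      nlinarith
    have hwn : ‖w‖ ≤ 3 + ‖u‖ := by
      have h2 : ‖w - u‖ ≤ |(w - u).re| + |(w - u).im| := norm_le_abs_re_add_abs_im _
      have h3 : |(w - u).re| ≤ 1 := by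
        rw [sub_re, abs_le]; constructor <;> linarith
      have h4 : |(w - u).im| ≤ 1 := by
        rw [sub_im, abs_le]; constructor <;> linarith
      have h5 : ‖w‖ ≤ ‖w - u‖ + ‖u‖ := by simpa using norm_add_le (w - u) u
      linarith
    have hR := norm_xiRatio_le_of_re_le_one hx hx1
    have hR0 := norm_nonneg (xiRatio w)
    have hPx : ‖P w‖ ≤ 9 * x ^ 2 := by
      rw [hPn]
      rw [frontier_reProdIm, frontier_Ioo zero_lt_one, frontier_Ioo him] at hw
      rcases hw with hw | hw
      · have hyy : y ^ 2 = 1 := by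
          rcases hw.2 with h | h
          · have : y = -1 := by rw [hy, h]; ring
            rw [this]; norm_num
          · have : y = 1 := by
              rw [mem_singleton_iff] at h
              rw [hy, h]; ring
            rw [this]; norm_num
        have : (x ^ 2 - y ^ 2 + 1) ^ 2 + (2 * x * y) ^ 2 = x ^ 2 * x ^ 2 + 4 * x ^ 2 := by
          rw [mul_pow, hyy]; ring
        rw [this]
        nlinarith
      · have hx' : x = 1 := by
          rcases hw.1 with h | h
          · exact absurd h hx.ne'
          · exact h
        rw [hx']
        nlinarith
    calc ‖P w * xiRatio w‖ = ‖P w‖ * ‖xiRatio w‖ := norm_mul _ _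
      _ ≤ 9 * x ^ 2 * ‖xiRatio w‖ := by gcongr
      _ = 9 * (x ^ 2 * ‖xiRatio w‖) := by ring
      _ ≤ 9 * (6 * (2 + ‖w‖)) := by gcongr
      _ ≤ 54 * (5 + ‖u‖) := by linarith
  have hmem : u ∈ closure U := by
    rw [hcl, mem_reProdIm]
    exact ⟨⟨hu.le, h1.le⟩, by linarith, by linarith⟩
  have hmain := norm_le_of_forall_mem_frontier_norm_le hbdd hd hbound hmem
  have hPu : 1 ≤ ‖P u‖ := by
    have : P u = (((u.re ^ 2 + 1) ^ 2 : ℝ) : ℂ) := by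
      have h2 : u - u.im * I = u.re := by apply Complex.ext <;> simp
      simp only [hP, h2]
      push_cast
      rfl
    rw [this, norm_real, Real.norm_of_nonneg (by positivity)]
    nlinarith [sq_nonneg u.re]
  calc ‖xiRatio u‖ ≤ ‖P u‖ * ‖xiRatio u‖ := le_mul_of_one_le_left (norm_nonneg _) hPu
    _ = ‖P u * xiRatio u‖ := (norm_mul _ _).symm
    _ ≤ _ := hmain

lemma norm_xiRatio_le_one {u : ℂ} (hu : 0 ≤ u.re) : ‖xiRatio u‖ ≤ 1 := by
  refine PhragmenLindelof.right_half_plane_of_bounded_on_real ?_ ⟨1, one_lt_two, 1, ?_⟩ ?_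
    (fun x ↦ (norm_xiRatio_mul_I x).le) hu
  · refine DifferentiableOn.diffContOnCl fun w hw ↦ ?_
    rw [closure_setOfPred_lt_re] at hw
    exact (differentiableAt_xiRatio hw).differentiableWithinAt
  · refine IsBigO.of_bound 270 (eventually_inf_principal.2 (Eventually.of_forall fun w hw ↦ ?_))
    have h1 := norm_xiRatio_le_linear hw
    have h2 := Real.add_one_le_exp ‖w‖
    have h3 := norm_nonneg w
    rw [Real.norm_of_nonneg (Real.exp_pos _).le, Real.rpow_one, one_mul]
    linarith
  · refine isBoundedUnder_of_eventually_le (a := 12) ?_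
    filter_upwards [eventually_ge_atTop 1] with x hx
    have hx0 : 0 < x := by linarith
    refine (norm_xiRatio_le (u := x) (by simpa using hx0)).trans ?_
    have h1 : ‖(x : ℂ) - 1‖ = x - 1 := by
      rw [← ofReal_one, ← ofReal_sub, norm_real, Real.norm_of_nonneg (by linarith)]
    rw [h1, ofReal_re]
    have h2 : (x - 1) / x ≤ 1 := (div_le_one hx0).2 (by linarith)
    have h3 : 1 / x ≤ 1 := (div_le_one hx0).2 hx
    calc _ ≤ 2 * (1 + 1) * (2 + 1 : ℝ) := by gcongr
      _ = 12 := by norm_num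

lemma isOpen_rightHalfPlane : IsOpen {z : ℂ | 0 < z.re} :=
  isOpen_lt continuous_const continuous_re

/-- The Schwarz–Pick inequality on the right half-plane, at a real base point with real value. -/
lemma schwarzPick_rightHalfPlane {H : ℂ → ℂ} (hd : DifferentiableOn ℂ H {z | 0 < z.re})
    (hlt : ∀ u : ℂ, 0 < u.re → ‖H u‖ < 1) {v r : ℝ} (hv : 0 < v) (hr : H v = r) {u : ℂ}
    (hu : 0 < u.re) : ‖H u - r‖ * ‖u + v‖ ≤ ‖u - v‖ * ‖1 - r * H u‖ := by
  have hr1 : |r| < 1 := by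
    have := hlt v (by simpa using hv)
    rwa [hr, norm_real] at this
  have hden : ∀ w : ℂ, 0 < w.re → 1 - r * H w ≠ 0 := by
    intro w hw h
    have h1 : ‖(r : ℂ) * H w‖ = 1 := by rw [← sub_eq_zero.1 h, norm_one]
    rw [norm_mul, norm_real, Real.norm_eq_abs] at h1
    nlinarith [hlt w hw, norm_nonneg (H w), abs_nonneg r]
  set C : ℂ → ℂ := fun z ↦ v * ((1 + z) / (1 - z)) with hC
  have hne : ∀ z ∈ Metric.ball (0 : ℂ) 1, 1 - z ≠ 0 := by
    intro z hz h
    rw [mem_ball_zero_iff, ← sub_eq_zero.1 h, norm_one] at hz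
    exact lt_irrefl _ hz
  have hCre : ∀ z ∈ Metric.ball (0 : ℂ) 1, 0 < (C z).re := by
    intro z hz
    have hn := normSq_pos.2 (hne z hz)
    have hz' : normSq z < 1 := by
      rw [normSq_eq_norm_sq]
      rw [mem_ball_zero_iff] at hz
      nlinarith [norm_nonneg z]
    rw [hC]
    simp only [re_ofReal_mul, div_re]
    rw [← add_div]
    refine mul_pos hv (div_pos ?_ hn)
    rw [normSq_apply] at hz'
    simp
    nlinarith
  set f : ℂ → ℂ := fun z ↦ (H (C z) - r) / (1 - r * H (C z)) with hf
  have hHC : DifferentiableOn ℂ (fun z ↦ H (C z)) (Metric.ball 0 1) := by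
    refine hd.comp (fun z hz ↦ ?_) hCre
    have := hne z hz
    exact DifferentiableAt.differentiableWithinAt (by fun_prop (disch := assumption))
  have hfd : DifferentiableOn ℂ f (Metric.ball 0 1) :=
    (hHC.sub_const _).div ((hHC.const_mul _).const_sub _) fun z hz ↦ hden _ (hCre z hz)
  have hmaps : MapsTo f (Metric.ball 0 1) (Metric.closedBall 0 1) := by
    intro z hz
    have h1 := hlt _ (hCre z hz)
    rw [mem_closedBall_zero_iff, hf]
    simp only [norm_div]
    refine div_le_one_of_le₀ ?_ (norm_nonneg _)
    rw [← sq_le_sq₀ (norm_nonneg _) (norm_nonneg _), ← normSq_eq_norm_sq, ← normSq_eq_norm_sq]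
    have h2 : normSq (H (C z)) ≤ 1 := by
      rw [normSq_eq_norm_sq]; nlinarith [norm_nonneg (H (C z))]
    have h3 : r ^ 2 ≤ 1 := (sq_le_one_iff_abs_le_one r).2 hr1.le
    rw [normSq_apply] at h2
    simp only [normSq_apply, sub_re, sub_im, ofReal_re, ofReal_im, mul_re, mul_im, one_re, one_im]
    nlinarith [mul_nonneg (sub_nonneg.2 h2) (sub_nonneg.2 h3)]
  have hf0 : f 0 = 0 := by simp [hf, hC, hr]
  have huv : u + v ≠ 0 := by
    intro h; have := congrArg re h; simp at this; linarith
  have hnorm : ‖(u - v) / (u + v)‖ < 1 := by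
    rw [norm_div, div_lt_one (norm_pos_iff.2 huv),
      ← sq_lt_sq₀ (norm_nonneg _) (norm_nonneg _), ← normSq_eq_norm_sq, ← normSq_eq_norm_sq]
    simp [normSq_apply]
    nlinarith [mul_pos hv hu]
  have hCu : C ((u - v) / (u + v)) = u := by
    have hv' : (v : ℂ) ≠ 0 := by exact_mod_cast hv.ne'
    have h1 : 1 + (u - v) / (u + v) = 2 * u / (u + v) := by field_simp; ring
    have h2 : 1 - (u - v) / (u + v) = 2 * v / (u + v) := by field_simp; ring
    simp only [hC, h1, h2]
    field_simp
  have h := norm_le_norm_of_mapsTo_ball hfd hmaps hf0 hnorm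
  simp only [hf, hCu, norm_div] at h
  rwa [div_le_div_iff₀ (norm_pos_iff.2 (hden u hu)) (norm_pos_iff.2 huv)] at h

/-- Julia's inequality at the boundary point `0` of the right half-plane. -/
lemma julia_rightHalfPlane {H : ℂ → ℂ} (hd : DifferentiableOn ℂ H {z | 0 < z.re})
    (hlt : ∀ u : ℂ, 0 < u.re → ‖H u‖ < 1) (hreal : ∀ v : ℝ, 0 < v → H v = (H v).re)
    (h0 : H 0 = 1) {κ : ℝ} (hderiv : HasDerivAt H (-(2 * κ) : ℝ) 0) {u : ℂ} (hu : 0 < u.re) :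
    u.re * normSq (1 - H u) ≤ κ * (1 - normSq (H u)) * normSq u := by
  have hρ : HasDerivAt (fun v : ℝ ↦ (H v).re) (-(2 * κ)) 0 := by
    exact HasDerivAt.real_of_complex (z := 0) (e := H) hderiv
  have hρ0 : (H ((0 : ℝ) : ℂ)).re = 1 := by simp [h0]
  have hsq : HasDerivAt (fun v : ℝ ↦ 1 - (H v).re ^ 2) (4 * κ) 0 := by
    refine ((hρ.pow 2).const_sub 1).congr_deriv ?_
    rw [hρ0]
    ring
  have hslope : Tendsto (fun v : ℝ ↦ (1 - (H v).re ^ 2) / v) (𝓝[>] 0) (𝓝 (4 * κ)) := by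
    have h1 := (hasDerivAt_iff_tendsto_slope.1 hsq).mono_left
      (nhdsWithin_mono _ fun x (hx : 0 < x) ↦ hx.ne')
    refine h1.congr fun v ↦ ?_
    simp [slope_def_field, h0]
  have hcont : Tendsto (fun v : ℝ ↦ (H v).re) (𝓝[>] 0) (𝓝 1) := by
    have := hρ.continuousAt.tendsto.mono_left (nhdsWithin_le_nhds (s := Ioi 0))
    rwa [hρ0] at this
  have hid : Tendsto (fun v : ℝ ↦ (v : ℂ)) (𝓝[>] 0) (𝓝 0) := by
    have := (continuous_ofReal.tendsto (0 : ℝ)).mono_left (nhdsWithin_le_nhds (s := Ioi 0))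
    simpa using this
  have hLHS : Tendsto (fun v : ℝ ↦ 4 * u.re * normSq (1 - ((H v).re : ℂ) * H u)) (𝓝[>] 0)
      (𝓝 (4 * u.re * normSq (1 - ((1 : ℝ) : ℂ) * H u))) := by
    refine Tendsto.const_mul _ ((continuous_normSq.tendsto _).comp ?_)
    exact tendsto_const_nhds.sub
      (((continuous_ofReal.tendsto _).comp hcont).mul tendsto_const_nhds)
  have hRHS : Tendsto (fun v : ℝ ↦ (1 - (H v).re ^ 2) / v * (1 - normSq (H u)) * normSq (u + v))
      (𝓝[>] 0) (𝓝 (4 * κ * (1 - normSq (H u)) * normSq (u + 0))) :=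
    (hslope.mul_const _).mul ((continuous_normSq.tendsto _).comp (tendsto_const_nhds.add hid))
  have hle := le_of_tendsto_of_tendsto hLHS hRHS ?_
  · rw [ofReal_one, one_mul, add_zero] at hle
    linarith
  · filter_upwards [self_mem_nhdsWithin] with v hv
    have hv : 0 < v := hv
    have hsp := schwarzPick_rightHalfPlane hd hlt hv (hreal v hv) hu
    set r := (H v).re
    have hsp2 := mul_self_le_mul_self (by positivity) hsp
    have e1 : ‖H u - r‖ * ‖u + v‖ * (‖H u - r‖ * ‖u + v‖) =
        normSq (H u - r) * normSq (u + v) := by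
      rw [normSq_eq_norm_sq, normSq_eq_norm_sq]; ring
    have e2 : ‖u - v‖ * ‖1 - r * H u‖ * (‖u - v‖ * ‖1 - r * H u‖) =
        normSq (u - v) * normSq (1 - r * H u) := by
      rw [normSq_eq_norm_sq, normSq_eq_norm_sq]; ring
    rw [e1, e2] at hsp2
    have e3 : normSq (H u - r) =
        normSq (1 - r * H u) - (1 - r ^ 2) * (1 - normSq (H u)) := by
      simp [normSq_apply]; ring
    have e4 : normSq (u - v) = normSq (u + v) - 4 * v * u.re := by
      simp [normSq_apply]; ring
    rw [e3, e4] at hsp2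
    rw [div_mul_eq_mul_div, div_mul_eq_mul_div, le_div_iff₀ hv]
    linarith

/-- A self-map of the disc fixing the boundary point, with boundary derivative at most one, has no
interior fixed point other than for the identity; stated on the right half-plane, where the
identity of the disc corresponds to `u ↦ (1 - u) / (1 + u)`. -/
lemma eq_zero_of_fixedPoint_rightHalfPlane {H : ℂ → ℂ}
    (hd : DifferentiableOn ℂ H {z | 0 < z.re})
    (hlt : ∀ u : ℂ, 0 < u.re → ‖H u‖ < 1) (hreal : ∀ v : ℝ, 0 < v → H v = (H v).re)
    (h0 : H 0 = 1) {κ : ℝ} (hκ : κ ≤ 1) (hderiv : HasDerivAt H (-(2 * κ) : ℝ) 0) {u : ℂ}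
    (hu : 0 < u.re) (hfix : H u = (1 - u) / (1 + u)) : H 1 = 0 := by
  have hne : ∀ w : ℂ, 0 < w.re → 1 - H w ≠ 0 := by
    intro w hw h
    have := hlt w hw
    rw [← sub_eq_zero.1 h, norm_one] at this
    exact lt_irrefl _ this
  have hne0 : ∀ w : ℂ, 0 < w.re → w ≠ 0 := by
    rintro w hw rfl; simp at hw
  set M : ℂ → ℂ := fun w ↦ (1 + H w) / (1 - H w) - 1 / w with hM
  have hMre : ∀ w : ℂ, 0 < w.re → 0 ≤ (M w).re := by
    intro w hw
    have hj := julia_rightHalfPlane hd hlt hreal h0 hderiv hw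
    have hn1 := normSq_pos.2 (hne w hw)
    have hn2 := normSq_pos.2 (hne0 w hw)
    have hH1 : 0 ≤ 1 - normSq (H w) := by
      rw [normSq_eq_norm_sq]; nlinarith [hlt w hw, norm_nonneg (H w)]
    have hj' : w.re * normSq (1 - H w) ≤ (1 - normSq (H w)) * normSq w := by
      refine hj.trans ?_
      have := mul_nonneg hH1 hn2.le
      nlinarith
    have e1 : ((1 + H w) / (1 - H w)).re = (1 - normSq (H w)) / normSq (1 - H w) := by
      rw [div_re, ← add_div]
      congr 1
      simp [normSq_apply]; ring
    have e2 : (1 / w).re = w.re / normSq w := by simp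
    rw [hM]
    simp only [sub_re]
    rw [e1, e2, sub_nonneg, div_le_div_iff₀ hn2 hn1]
    exact hj'
  have hMd : DifferentiableOn ℂ M {z | 0 < z.re} :=
    ((hd.const_add 1).div (hd.const_sub 1) hne).sub
      ((differentiableOn_const _).div differentiableOn_id hne0)
  have hMu : M u = 0 := by
    have hu1 : 1 + u ≠ 0 := by
      intro h; have := congrArg re h; simp at this; linarith
    have h1 : 1 + (1 - u) / (1 + u) = 2 / (1 + u) := by field_simp; ring
    have h2 : 1 - (1 - u) / (1 + u) = 2 * u / (1 + u) := by field_simp; ring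
    have := hne0 u hu
    simp only [hM, hfix, h1, h2]
    field_simp
    ring
  rcases (hMd.analyticOnNhd isOpen_rightHalfPlane).is_constant_or_isOpen
    (convex_halfSpace_re_gt 0).isPreconnected with ⟨c, hc⟩ | hopen
  · have h1 : M 1 = 0 := by rw [hc 1 (by simp), ← hc u hu, hMu]
    have h2 := hne 1 (by simp)
    simp only [hM, div_one, sub_eq_zero] at h1
    rw [div_eq_one_iff_eq h2] at h1
    linear_combination h1 / 2
  · have hO := hopen _ Subset.rfl isOpen_rightHalfPlane
    obtain ⟨ε, hε, hball⟩ := Metric.isOpen_iff.1 hO 0 ⟨u, hu, hMu⟩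
    obtain ⟨w, hw, hwM⟩ := hball (show ((-(ε / 2) : ℝ) : ℂ) ∈ Metric.ball 0 ε by
      rw [mem_ball_zero_iff, norm_real, Real.norm_eq_abs, abs_neg, abs_of_pos (by positivity)]
      linarith)
    have := hMre w hw
    rw [hwM, ofReal_re] at this
    linarith

lemma entireXi_two : entireXi 2 = (Real.pi / 3 : ℝ) := by
  have hpi : (Real.pi : ℂ) ≠ 0 := by exact_mod_cast Real.pi_ne_zero
  rw [entireXi_eq two_ne_zero (by norm_num), completedRiemannZeta_eq_Gammaℝ_mul (by norm_num),
    riemannZeta_two, Gammaℝ_def, neg_div, div_self two_ne_zero, cpow_neg_one, Gamma_one]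
  push_cast
  field_simp
  norm_num

lemma hasDerivAt_xiRatio_zero :
    HasDerivAt xiRatio
      (-(Real.eulerMascheroniConstant - Real.log (4 * Real.pi) + 2) : ℝ) 0 := by
  have hΛ (s : ℂ) := (differentiable_completedZeta₀ s).hasDerivAt
  have hX (s : ℂ) : HasDerivAt entireXi ((2 * s - 1) * completedRiemannZeta₀ s +
      s * (s - 1) * deriv completedRiemannZeta₀ s) s := by
    have h1 : HasDerivAt (fun s : ℂ ↦ s * (s - 1)) (2 * s - 1) s := by
      refine ((hasDerivAt_id s).mul ((hasDerivAt_id s).sub_const 1)).congr_deriv ?_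
      simp; ring
    exact (h1.mul (hΛ s)).const_add 1
  have hX1 : HasDerivAt (fun u ↦ entireXi (1 + u)) _ 0 :=
    HasDerivAt.comp_const_add 1 0 (hX (1 + 0))
  have h01 : completedRiemannZeta₀ 0 = completedRiemannZeta₀ 1 := by
    rw [← completedRiemannZeta₀_one_sub, sub_zero]
  have hlog : Complex.log (4 * Real.pi) = (Real.log (4 * Real.pi) : ℝ) := by
    rw [ofReal_log (by positivity)]
    push_cast
    rfl
  refine ((hX 0).div hX1 (by simp [entireXi_one])).congr_deriv ?_
  simp only [add_zero, entireXi_one, entireXi_zero, h01, completedRiemannZeta₀_one, hlog]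
  push_cast
  ring

lemma cpow_mul_xiRatio_ne_div {a : ℝ} (ha : 1 ≤ a) (ha' : a ≤ aStar) {u : ℂ}
    (hu : 0 < u.re) : (a : ℂ) ^ (-u) * xiRatio u ≠ (1 - u) / (1 + u) := by
  intro hfix
  have ha0 : 0 < a := by linarith
  have haC : (a : ℂ) ≠ 0 := by exact_mod_cast ha0.ne'
  set H : ℂ → ℂ := fun w ↦ (a : ℂ) ^ (-w) * xiRatio w with hH
  have hd : DifferentiableOn ℂ H {z | 0 < z.re} := by
    intro w hw
    refine DifferentiableAt.differentiableWithinAt (DifferentiableAt.mul ?_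
      (differentiableAt_xiRatio (le_of_lt hw)))
    exact differentiableAt_id.neg.const_cpow (Or.inl haC)
  have hle : ∀ w : ℂ, 0 < w.re → ‖H w‖ ≤ 1 := by
    intro w hw
    rw [hH]
    simp only [norm_mul]
    rw [norm_cpow_eq_rpow_re_of_pos ha0]
    refine mul_le_one₀ ?_ (norm_nonneg _) (norm_xiRatio_le_one hw.le)
    exact Real.rpow_le_one_of_one_le_of_nonpos ha (by simpa using hw.le)
  have hH1 : H 1 = ((a⁻¹ * (Real.pi / 3)⁻¹ : ℝ) : ℂ) := by
    simp only [hH, xiRatio, entireXi_one, one_add_one_eq_two, entireXi_two, cpow_neg_one]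
    push_cast
    ring
  have hpi := Real.pi_gt_three
  have hH1n : ‖H 1‖ < 1 := by
    rw [hH1, norm_real, Real.norm_of_nonneg (by positivity)]
    refine mul_lt_one_of_nonneg_of_lt_one_right (inv_le_one_of_one_le₀ ha) (by positivity) ?_
    exact inv_lt_one_of_one_lt₀ (by linarith)
  have hlt : ∀ w : ℂ, 0 < w.re → ‖H w‖ < 1 := by
    intro w hw
    refine (hle w hw).lt_of_ne fun h ↦ ?_
    have hmax : IsMaxOn (norm ∘ H) {z | 0 < z.re} w := fun z hz ↦ by
      simpa [h] using hle z hz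
    have := eqOn_of_isPreconnected_of_isMaxOn_norm (convex_halfSpace_re_gt 0).isPreconnected
      isOpen_rightHalfPlane hd hw hmax (show (1 : ℂ) ∈ {z : ℂ | 0 < z.re} by simp)
    rw [this, Function.const_apply, h] at hH1n
    exact lt_irrefl _ hH1n
  have hreal : ∀ v : ℝ, 0 < v → H v = (H v).re := by
    intro v hv
    have h1 : ∀ x : ℝ, 0 < x → conj (entireXi x) = entireXi x := by
      intro x hx
      rw [← entireXi_conj_of_re_pos (by simpa using hx), conj_ofReal]
    have h2 := h1 (1 + v) (by linarith)
    push_cast at h2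
    have h3 : (a : ℂ) ^ (-(v : ℂ)) = ((a ^ (-v) : ℝ) : ℂ) := by
      rw [ofReal_cpow ha0.le]; push_cast; rfl
    refine (conj_eq_iff_re.1 ?_).symm
    simp only [hH, xiRatio, map_mul, map_div₀, h1 v hv, h2, h3, conj_ofReal]
  have h0 : H 0 = 1 := by simp [hH, xiRatio, entireXi_zero, entireXi_one]
  set κ := (Real.log a + (Real.eulerMascheroniConstant - Real.log (4 * Real.pi) + 2)) / 2 with hκ
  have hκ1 : κ ≤ 1 := by
    have hlog := Real.log_le_log ha0 ha'
    rw [aStar, Real.log_mul (by positivity) (Real.exp_pos _).ne', Real.log_exp] at hlog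
    rw [hκ]
    linarith
  have hderiv : HasDerivAt H (-(2 * κ) : ℝ) 0 := by
    have h1 : HasDerivAt (fun w : ℂ ↦ (a : ℂ) ^ (-w)) _ 0 :=
      (hasDerivAt_neg (0 : ℂ)).const_cpow (Or.inl haC)
    refine (h1.mul hasDerivAt_xiRatio_zero).congr_deriv ?_
    rw [hκ]
    simp [xiRatio, entireXi_zero, entireXi_one, ← ofReal_log ha0.le]
    ring
  have hzero := eq_zero_of_fixedPoint_rightHalfPlane hd hlt hreal h0 hκ1 hderiv hu hfix
  rw [hH1, ofReal_eq_zero] at hzero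
  have : 0 < a⁻¹ * (Real.pi / 3)⁻¹ := by positivity
  exact this.ne' hzero

lemma phi0_one_sub (a : ℝ) (s : ℂ) : phi0 a (1 - s) = phi0 a s := by
  have h1 : completedRiemannZeta (2 * (1 - s)) = completedRiemannZeta (2 * s - 1) := by
    rw [← completedRiemannZeta_one_sub]; ring_nf
  have h2 : completedRiemannZeta (2 * (1 - s) - 1) = completedRiemannZeta (2 * s) := by
    rw [← completedRiemannZeta_one_sub]; ring_nf
  rw [phi0, phi0, h1, h2, sub_sub_cancel, add_comm]

lemma phi0_ne_zero_of_one_half_lt_re {a : ℝ} (ha : 1 ≤ a) (ha' : a ≤ aStar) {s : ℂ}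
    (hs : 1 / 2 < s.re) (hs1 : s ≠ 1) : phi0 a s ≠ 0 := by
  intro hzero
  have ha0 : 0 < a := by linarith
  have haC : (a : ℂ) ≠ 0 := by exact_mod_cast ha0.ne'
  set u : ℂ := 2 * s - 1 with hu
  have hure : 0 < u.re := by simp [hu]; linarith
  have hu0 : u ≠ 0 := by rintro h; rw [h] at hure; simp at hure
  have hu1 : u ≠ 1 := fun h ↦ hs1 (by linear_combination h / 2)
  have h1u : 1 + u ≠ 0 := by
    intro h; have := congrArg re h; simp at this; linarith
  refine cpow_mul_xiRatio_ne_div ha ha' hure ?_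
  have e1 : 2 * s = 1 + u := by rw [hu]; ring
  have e2 : (a : ℂ) ^ (-u) = a ^ (1 - s) / a ^ s := by
    rw [← cpow_sub _ _ haC]; congr 1; rw [hu]; ring
  have has : (a : ℂ) ^ s ≠ 0 := by simp [cpow_eq_zero_iff, haC]
  rw [phi0, ← hu, e1] at hzero
  have hX := entireXi_one_add_ne_zero hure.le
  rw [xiRatio, e2, div_mul_div_comm, div_eq_div_iff (mul_ne_zero has hX) h1u,
    entireXi_eq h1u (by simpa using hu0), entireXi_eq hu0 hu1]
  linear_combination (u * (u - 1) * (1 + u)) * hzero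

end

/-- If `1 ≤ a ≤ a* = 4πe^{-γ}`, then every zero of `φ₀(a,·)` away from `0, 1/2, 1`
lies on the critical line `Re(s) = 1/2`. -/
theorem phi0_all_zeros_on_critical_line (a : ℝ) (ha : 1 ≤ a) (ha' : a ≤ aStar)
    (s : ℂ) (hs : s ∉ ({0, 1 / 2, 1} : Set ℂ)) (hzero : phi0 a s = 0) :
    s.re = 1 / 2 := by
  have key := fun {z : ℂ} (h : 1 / 2 < z.re) (h1 : z ≠ 1) ↦
    phi0_ne_zero_of_one_half_lt_re ha ha' h h1
  simp only [Set.mem_insert_iff, Set.mem_singleton_iff, not_or] at hs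
  rcases lt_trichotomy s.re (1 / 2) with h | h | h
  · refine absurd ((phi0_one_sub a s).trans hzero) (key ?_ ?_)
    · rw [sub_re, one_re]; linarith
    · simpa using hs.1
  · exact h
  · exact absurd hzero (key h hs.2.2)
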